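/- arXiv:1108.6114 — 7 statements merged into one kernel-verified Lean document; each statement's English description precedes it below -/
import Mathlib

section
/- The cardinality of the algebraic toric set X associated to the matrix A satisfies |M| · |X| = ∏_{i=1}^n |Y_i|; that is, |X| = (1/|M|) · ∏_{i=1}^n |Y_i|. -/
open Finset MvPolynomial

noncomputable section

/-- `b i j = a i j - a 0 j` (i.e. `b_{ij} = a_{ij} - a_{1j}`). -/
def bmat {m n : ℕ} [NeZero m] (a : Fin m → Fin n → ℕ) (i : Fin m) (j : Fin n) : ℤ :=
  (a i j : ℤ) - (a 0 j : ℤ)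

/-- The (normalized) algebraic toric set associated to the matrix `a`. -/
def toricSet (K : Type) [Field K] {m n : ℕ} [NeZero m] (a : Fin m → Fin n → ℕ) :
    Set (Fin m → Kˣ) :=
  {x | ∃ t : Fin n → Kˣ, ∀ i, x i = ∏ j, t j ^ bmat a i j}

/-- The subgroup `Y_j = {(1, t^{b_{2j}}, …, t^{b_{mj}}) : t ∈ K*}`. -/
def Ysub (K : Type) [Field K] {m n : ℕ} [NeZero m] (a : Fin m → Fin n → ℕ) (j : Fin n) :
    Set (Fin m → Kˣ) :=
  {x | ∃ t : Kˣ, ∀ i, x i = t ^ bmat a i j}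

/-- `gcd(q-1, b_{2j}, …, b_{mj})`. -/
def gcdCol (q : ℕ) {m n : ℕ} [NeZero m] (a : Fin m → Fin n → ℕ) (j : Fin n) : ℕ :=
  Nat.gcd (q - 1) (Finset.univ.gcd fun i : Fin m => (bmat a i j).natAbs)

/-- The set `M` of integer tuples `(i_1, …, i_n)` with
`1 ≤ i_j ≤ (q-1)/gcd(q-1, b_{2j},…,b_{mj})` and
`i_1 b_{k1} + ⋯ + i_n b_{kn} ≡ 0 (mod q-1)` for every `k`. -/
def Mset (q : ℕ) {m n : ℕ} [NeZero m] (a : Fin m → Fin n → ℕ) : Set (Fin n → ℤ) :=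
  {v | (∀ j, 1 ≤ v j ∧ v j ≤ ((q - 1) / gcdCol q a j : ℕ)) ∧
       ∀ k : Fin m, ((q : ℤ) - 1) ∣ ∑ j, v j * bmat a k j}

/-- The (normalized) projective torus `T_{m-1} = {(1, c_2, …, c_m) : c_i ∈ K*}`. -/
def projTorus (K : Type) [Field K] (m : ℕ) [NeZero m] : Set (Fin m → Kˣ) :=
  {x | x 0 = 1}

/-- The evaluation linear map `ev_d : f ↦ (f(P)/P_1^d)_{P ∈ Z}`. -/
def evLM (K : Type) [Field K] {m : ℕ} [NeZero m] (Z : Set (Fin m → Kˣ)) (d : ℕ) :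
    MvPolynomial (Fin m) K →ₗ[K] (Z → K) where
  toFun f := fun P => eval (fun i => ((P : Fin m → Kˣ) i : K)) f / (((P : Fin m → Kˣ) 0 : K) ^ d)
  map_add' f g := by funext P; simp [add_div]
  map_smul' c f := by funext P; simp [smul_eq_mul, mul_div_assoc]

/-- The projective parameterized code `C_Z(d)`, the image under `ev_d` of the
space of homogeneous polynomials of degree `d`. -/
def evalCode (K : Type) [Field K] {m : ℕ} [NeZero m] (Z : Set (Fin m → Kˣ)) (d : ℕ) :
    Submodule K (Z → K) :=
  Submodule.map (evLM K Z d) (homogeneousSubmodule (Fin m) K d)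

/-- `H_Z(d) = dim_K C_Z(d)`. -/
def hilbF (K : Type) [Field K] {m : ℕ} [NeZero m] (Z : Set (Fin m → Kˣ)) (d : ℕ) : ℕ :=
  Module.finrank K (evalCode K Z d)

/-- Hamming weight: the number of nonzero entries. -/
def wt {ι K : Type*} [Zero K] (v : ι → K) : ℕ := {i | v i ≠ 0}.ncard

/-- The minimum distance `δ_Z(d)` of the code `C_Z(d)`. -/
def minDist (K : Type) [Field K] {m : ℕ} [NeZero m] (Z : Set (Fin m → Kˣ)) (d : ℕ) : ℕ :=
  sInf {w | ∃ v ∈ evalCode K Z d, v ≠ 0 ∧ wt v = w}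

/-- The regularity index: the least `p` such that `H_Z(d) = |Z|` for all `d ≥ p`. -/
def regIndex (K : Type) [Field K] {m : ℕ} [NeZero m] (Z : Set (Fin m → Kˣ)) : ℕ :=
  sInf {p | ∀ d ≥ p, hilbF K Z d = Z.ncard}

/-- `I_Z(d)`: the degree-`d` piece of the vanishing ideal of `Z`. -/
def vanishPiece (K : Type) [Field K] {m : ℕ} [NeZero m] (Z : Set (Fin m → Kˣ)) (d : ℕ) :
    Submodule K (MvPolynomial (Fin m) K) :=
  (homogeneousSubmodule (Fin m) K d) ⊓
    ⨅ P ∈ Z, LinearMap.ker (MvPolynomial.aeval (R := K) fun i => ((P i : K))).toLinearMap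


theorem zpow_injOn_Icc_orderOf {G : Type*} [Group G] (u : G) :
    Set.InjOn (fun k : ℤ => u ^ k) (Set.Icc 1 (orderOf u : ℤ)) := by
  rintro v ⟨hv1, hv2⟩ w ⟨hw1, hw2⟩ h
  have hdvd := (zpow_eq_zpow_iff_modEq.1 h).dvd
  have := Int.eq_zero_of_abs_lt_dvd hdvd (by rw [abs_lt]; constructor <;> linarith)
  linarith

theorem exists_zpow_eq_mem_Icc_orderOf {G : Type*} [Group G] [Finite G] (u : G) (k : ℤ) :
    ∃ v ∈ Set.Icc 1 (orderOf u : ℤ), u ^ v = u ^ k := by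
  have hpos : (0 : ℤ) < orderOf u := by exact_mod_cast orderOf_pos u
  have h1 := Int.emod_nonneg (k - 1) hpos.ne'
  have h2 := Int.emod_lt_of_pos (k - 1) hpos
  refine ⟨(k - 1) % orderOf u + 1, ⟨by linarith, by linarith⟩, ?_⟩
  rw [zpow_add, zpow_mod_orderOf, ← zpow_add, sub_add_cancel]

theorem zpow_sum_eq_prod_zpow {ι G : Type*} [CommGroup G] (g : G) (s : Finset ι) (f : ι → ℤ) :
    g ^ ∑ i ∈ s, f i = ∏ i ∈ s, g ^ f i := by
  classical
  induction s using Finset.induction_on with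
  | empty => simp
  | insert i s hi ih => rw [Finset.sum_insert hi, Finset.prod_insert hi, zpow_add, ih]

/-- The relations among elements of a finite commutative group, with exponents reduced modulo
the orders, count the fibres of the product map from the product of cyclic subgroups. -/
theorem ncard_relations_mul_ncard_products {ι H : Type*} [Fintype ι] [CommGroup H] [Finite H]
    (u : ι → H) :
    {v : ι → ℤ | (∀ j, v j ∈ Set.Icc 1 (orderOf (u j) : ℤ)) ∧ ∏ j, u j ^ v j = 1}.ncard *
      {x | ∃ k : ι → ℤ, x = ∏ j, u j ^ k j}.ncard = ∏ j, orderOf (u j) := by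
  classical
  let φ : (∀ j, Subgroup.zpowers (u j)) →* H :=
    { toFun := fun y => ∏ j, (y j : H)
      map_one' := by simp
      map_mul' := fun x y => by simp [Finset.prod_mul_distrib] }
  have hφ (y) : φ y = ∏ j, (y j : H) := rfl
  have hrange : {x | ∃ k : ι → ℤ, x = ∏ j, u j ^ k j} = (φ.range : Set H) := by
    ext x
    constructor
    · rintro ⟨k, rfl⟩
      exact ⟨fun j => ⟨u j ^ k j, k j, rfl⟩, rfl⟩
    · rintro ⟨y, rfl⟩
      choose k hk using fun j => (y j).2
      exact ⟨k, Finset.prod_congr rfl fun j _ => (hk j).symm⟩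
  have hker : {v : ι → ℤ | (∀ j, v j ∈ Set.Icc 1 (orderOf (u j) : ℤ)) ∧
      ∏ j, u j ^ v j = 1}.ncard = Nat.card φ.ker := by
    rw [← SetLike.coe_sort_coe, Nat.card_coe_set_eq]
    let F (v : ι → ℤ) (j : ι) : Subgroup.zpowers (u j) := ⟨u j ^ v j, v j, rfl⟩
    refine Set.ncard_congr (fun v _ => F v) ?_ ?_ ?_
    · intro v hv
      exact (hφ (F v)).trans hv.2
    · rintro v w ⟨hv, -⟩ ⟨hw, -⟩ h
      funext j
      have hj : u j ^ v j = u j ^ w j := congrArg Subtype.val (congrFun h j)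
      exact zpow_injOn_Icc_orderOf (u j) (hv j) (hw j) hj
    · intro y hy
      choose k hk using fun j => (y j).2
      choose v hv hvk using fun j => exists_zpow_eq_mem_Icc_orderOf (u j) (k j)
      have hvy : ∀ j, u j ^ v j = y j := fun j => (hvk j).trans (hk j)
      refine ⟨v, ⟨hv, ?_⟩, funext fun j => Subtype.ext (hvy j)⟩
      exact (Finset.prod_congr rfl fun j _ => hvy j).trans ((hφ y).symm.trans hy)
  rw [hrange, hker, ← Nat.card_coe_set_eq]
  change Nat.card φ.ker * Nat.card φ.range = _
  rw [← Subgroup.index_ker, Subgroup.card_mul_index, Nat.card_pi]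
  exact Finset.prod_congr rfl fun j _ => Nat.card_zpowers (u j)

theorem orderOf_pi_zpow {ι G : Type*} [Fintype ι] [Group G] [Finite G] (g : G) (b : ι → ℤ) :
    orderOf (fun i => g ^ b i) =
      orderOf g / (orderOf g).gcd (Finset.univ.gcd fun i => (b i).natAbs) := by
  set N := orderOf g with hN
  set c := Finset.univ.gcd fun i => (b i).natAbs with hc
  have hNpos : 0 < N := orderOf_pos g
  refine Nat.dvd_right_iff_eq.1 fun k => ?_
  have hpow : orderOf (fun i => g ^ b i) ∣ k ↔ N ∣ k * c := by
    have : k * c = Finset.univ.gcd fun i => k * (b i).natAbs := by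
      rw [Finset.gcd_mul_left, normalize_eq]
    rw [orderOf_dvd_iff_pow_eq_one, this, Finset.dvd_gcd_iff, funext_iff]
    refine forall_congr' fun i => ?_
    rw [Pi.pow_apply, Pi.one_apply, ← zpow_natCast, ← zpow_mul, ← orderOf_dvd_iff_zpow_eq_one,
      ← hN, Int.natCast_dvd, Int.natAbs_mul, Int.natAbs_natCast, mul_comm]
    simp
  rw [hpow]
  have hgpos : 0 < N.gcd c := Nat.gcd_pos_of_pos_left _ hNpos
  constructor
  · intro h
    refine (Nat.coprime_div_gcd_div_gcd hgpos).dvd_of_dvd_mul_right (n := c / N.gcd c) ?_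
    rw [← Nat.mul_div_assoc _ (Nat.gcd_dvd_right N c)]
    exact Nat.div_dvd_div (Nat.gcd_dvd_left N c) h
  · intro h
    rw [← Nat.div_mul_cancel (Nat.gcd_dvd_left N c)]
    exact mul_dvd_mul h (Nat.gcd_dvd_right N c)

/-- `|M| · |X| = ∏_{i=1}^n |Y_i|`. -/
theorem stmt0 {q m n : ℕ} (hq : IsPrimePow q) (hm : 2 ≤ m) (hn : 1 ≤ n) [NeZero m]
    (K : Type) [Field K] [Fintype K] (hK : Fintype.card K = q)
    (a : Fin m → Fin n → ℕ) :
    (Mset q a).ncard * (toricSet K a).ncard = ∏ j : Fin n, (Ysub K a j).ncard := by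
  obtain ⟨g, hg⟩ := IsCyclic.exists_generator (α := Kˣ)
  have hord : orderOf g = q - 1 := by
    rw [orderOf_eq_card_of_forall_mem_zpowers hg, Nat.card_units, Nat.card_eq_fintype_card, hK]
  set u : Fin n → Fin m → Kˣ := fun j i => g ^ bmat a i j with hu
  have hou : ∀ j, orderOf (u j) = (q - 1) / gcdCol q a j := fun j => by
    rw [gcdCol, ← hord, ← orderOf_pi_zpow]
  have hY : ∀ j, (Ysub K a j).ncard = orderOf (u j) := fun j => by
    rw [← Nat.card_zpowers, ← SetLike.coe_sort_coe, Nat.card_coe_set_eq]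
    congr 1
    ext x
    constructor
    · rintro ⟨t, ht⟩
      obtain ⟨k, rfl⟩ := hg t
      exact ⟨k, funext fun i => by simp [hu, ht, zpow_comm g k]⟩
    · rintro ⟨k, rfl⟩
      exact ⟨g ^ k, fun i => by simp [hu, zpow_comm g k]⟩
  have hX : toricSet K a = {x | ∃ k : Fin n → ℤ, x = ∏ j, u j ^ k j} := by
    ext x
    constructor
    · rintro ⟨t, ht⟩
      choose k hk using fun j => hg (t j)
      exact ⟨k, funext fun i => by simp [hu, ht, ← hk, zpow_comm g (k _)]⟩
    · rintro ⟨k, rfl⟩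
      exact ⟨fun j => g ^ k j, fun i => by simp [hu, zpow_comm g (k _)]⟩
  have hM : Mset q a = {v | (∀ j, v j ∈ Set.Icc 1 (orderOf (u j) : ℤ)) ∧
      ∏ j, u j ^ v j = 1} := by
    ext v
    have hq1 : (q : ℤ) - 1 = orderOf g := by
      rw [hord, Nat.cast_sub hq.one_lt.le, Nat.cast_one]
    refine and_congr (forall_congr' fun j => by rw [hou]; rfl) ?_
    rw [funext_iff]
    refine forall_congr' fun i => ?_
    rw [hq1, orderOf_dvd_iff_zpow_eq_one, zpow_sum_eq_prod_zpow]
    simp [hu, zpow_mul, zpow_comm g (v _)]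
  rw [hM, hX, ncard_relations_mul_ncard_products]
  exact Finset.prod_congr rfl fun j _ => (hY j).symm
end
end

section
/- The map φ : Y_1 × ⋯ × Y_n → X defined by φ(y_1,…,y_n) = y_1⋯y_n (componentwise product in (K*)^m) is a surjective group homomorphism, and its kernel has exactly |M| elements. -/
open Finset MvPolynomial

noncomputable section

/-- The group homomorphism `K* → (K*)^m`, `t ↦ (t^{b_{1j}}, …, t^{b_{mj}})`,
whose range is the subgroup `Y_j`. -/
def psiHom (K : Type) [Field K] {m n : ℕ} [NeZero m] (a : Fin m → Fin n → ℕ) (j : Fin n) :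
    Kˣ →* (Fin m → Kˣ) where
  toFun t := fun i => t ^ bmat a i j
  map_one' := by funext i; simp
  map_mul' s t := by funext i; simp [mul_zpow]

/-- The subgroup `Y_j` of `(K*)^m`. -/
def YsubGroup (K : Type) [Field K] {m n : ℕ} [NeZero m] (a : Fin m → Fin n → ℕ) (j : Fin n) :
    Subgroup (Fin m → Kˣ) := (psiHom K a j).range

/-- The group homomorphism `φ : Y_1 × ⋯ × Y_n → (K*)^m`,
`φ(y_1, …, y_n) = y_1 ⋯ y_n` (componentwise product). -/
def phiHom (K : Type) [Field K] {m n : ℕ} [NeZero m] (a : Fin m → Fin n → ℕ) :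
    ((j : Fin n) → YsubGroup K a j) →* (Fin m → Kˣ) where
  toFun y := ∏ j, (y j : Fin m → Kˣ)
  map_one' := by simp
  map_mul' u v := by simp [Finset.prod_mul_distrib]

/-- A modulus `N` divides every `z * b i` exactly when `N / gcd(N, b)` divides `z`. -/
theorem forall_natCast_dvd_mul_iff {ι : Type*} [Fintype ι] {N : ℕ} (hN : 0 < N) (b : ι → ℤ)
    (z : ℤ) :
    (∀ i, (N : ℤ) ∣ z * b i) ↔
      ((N / N.gcd (Finset.univ.gcd fun i => (b i).natAbs) : ℕ) : ℤ) ∣ z := by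
  have hnat : (∀ i, (N : ℤ) ∣ z * b i) ↔
      N ∣ z.natAbs * Finset.univ.gcd fun i => (b i).natAbs := by
    have hmul : z.natAbs * (Finset.univ.gcd fun i => (b i).natAbs) =
        Finset.univ.gcd fun i => z.natAbs * (b i).natAbs := by
      rw [Finset.gcd_mul_left, normalize_eq]
    rw [hmul, Finset.dvd_gcd_iff]
    simp [Int.natCast_dvd, Int.natAbs_mul]
  rw [hnat, Int.natCast_dvd]
  generalize (Finset.univ.gcd fun i => (b i).natAbs) = G
  have hd : 0 < N.gcd G := Nat.gcd_pos_of_pos_left _ hN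
  have hcop := Nat.coprime_div_gcd_div_gcd hd
  have hN' : N / N.gcd G * N.gcd G = N := Nat.div_mul_cancel (Nat.gcd_dvd_left N G)
  have hG' : G / N.gcd G * N.gcd G = G := Nat.div_mul_cancel (Nat.gcd_dvd_right N G)
  calc N ∣ z.natAbs * G
      ↔ N / N.gcd G * N.gcd G ∣ z.natAbs * (G / N.gcd G) * N.gcd G := by
        rw [mul_assoc, hN', hG']
    _ ↔ N / N.gcd G ∣ z.natAbs := by
        rw [Nat.mul_dvd_mul_iff_right hd, hcop.dvd_mul_right]

/-- The powers of `ψ_j(g)`, for `g` of order `q - 1`, repeat with period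
`(q - 1) / gcd(q - 1, b_{2j}, …, b_{mj})`. -/
theorem psiHom_zpow_eq_iff {K : Type} [Field K] {q m n : ℕ} [NeZero m] (a : Fin m → Fin n → ℕ)
    (j : Fin n) (hq : 0 < q - 1) {g : Kˣ} (hg : orderOf g = q - 1) (v w : ℤ) :
    psiHom K a j (g ^ v) = psiHom K a j (g ^ w) ↔
      (((q - 1) / gcdCol q a j : ℕ) : ℤ) ∣ v - w := by
  rw [gcdCol, ← forall_natCast_dvd_mul_iff hq, funext_iff]
  refine forall_congr' fun i => ?_
  change (g ^ v) ^ bmat a i j = (g ^ w) ^ bmat a i j ↔ _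
  rw [← zpow_mul, ← zpow_mul, ← hg, orderOf_dvd_iff_zpow_eq_one, sub_mul, zpow_sub, mul_inv_eq_one]

theorem range_phiHom (K : Type) [Field K] {m n : ℕ} [NeZero m] (a : Fin m → Fin n → ℕ) :
    Set.range (phiHom K a) = toricSet K a := by
  ext x
  constructor
  · rintro ⟨y, rfl⟩
    choose t ht using fun j => (y j).2
    refine ⟨t, fun i => ?_⟩
    change (∏ j, (y j : Fin m → Kˣ)) i = _
    rw [Finset.prod_apply]
    exact Finset.prod_congr rfl fun j _ => by rw [← ht j]; rfl
  · rintro ⟨t, ht⟩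
    refine ⟨fun j => ⟨psiHom K a j (t j), t j, rfl⟩, ?_⟩
    funext i
    change (∏ j, psiHom K a j (t j)) i = _
    rw [ht, Finset.prod_apply]
    rfl

/-- The tuple `(ψ_1(g^{v_1}), …, ψ_n(g^{v_n}))` lies in the kernel of `φ` exactly when
`v` satisfies the congruences defining `M`. -/
theorem psiHom_zpow_mem_ker_iff {K : Type} [Field K] {m n : ℕ} [NeZero m]
    (a : Fin m → Fin n → ℕ) (g : Kˣ) (v : Fin n → ℤ) :
    (fun j => (⟨psiHom K a j (g ^ v j), g ^ v j, rfl⟩ : YsubGroup K a j)) ∈ (phiHom K a).ker ↔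
      ∀ k, (orderOf g : ℤ) ∣ ∑ j, v j * bmat a k j := by
  rw [MonoidHom.mem_ker, funext_iff]
  refine forall_congr' fun k => ?_
  change (∏ j, psiHom K a j (g ^ v j)) k = 1 ↔ _
  rw [Finset.prod_apply, orderOf_dvd_iff_zpow_eq_one]
  have hprod : ∏ j, psiHom K a j (g ^ v j) k = g ^ ∑ j, v j * bmat a k j := by
    refine (Finset.prod_congr rfl fun j _ => (zpow_mul g (v j) (bmat a k j)).symm).trans ?_
    exact (map_sum (zmultiplesHom (Additive Kˣ) (Additive.ofMul g)) _ _).symm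
  rw [hprod]

/-- `φ` (a group homomorphism by construction) maps
`Y_1 × ⋯ × Y_n` onto `X`, and its kernel has exactly `|M|` elements. -/
theorem stmt2 {q m n : ℕ} (hq : IsPrimePow q) (hm : 2 ≤ m) (hn : 1 ≤ n) [NeZero m]
    (K : Type) [Field K] [Fintype K] (hK : Fintype.card K = q)
    (a : Fin m → Fin n → ℕ) :
    Set.range (phiHom K a) = toricSet K a ∧
    (((phiHom K a).ker : Set ((j : Fin n) → YsubGroup K a j))).ncard = (Mset q a).ncard := by
  refine ⟨range_phiHom K a, ?_⟩
  obtain ⟨g, hgen⟩ := IsCyclic.exists_generator (α := Kˣ)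
  have hone : 1 < q := hq.one_lt
  have hpos : 0 < q - 1 := by omega
  have hg : orderOf g = q - 1 := by
    rw [orderOf_eq_card_of_forall_mem_zpowers hgen, Nat.card_units, Nat.card_eq_fintype_card, hK]
  have hcast : (q : ℤ) - 1 = (orderOf g : ℤ) := by omega
  symm
  refine Set.ncard_congr
    (fun v _ j => (⟨psiHom K a j (g ^ v j), g ^ v j, rfl⟩ : YsubGroup K a j)) ?_ ?_ ?_
  · rintro v ⟨-, hv⟩
    exact (psiHom_zpow_mem_ker_iff a g v).2 (hcast ▸ hv)
  · rintro v w ⟨hv, -⟩ ⟨hw, -⟩ hvw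
    funext j
    have hdvd := (psiHom_zpow_eq_iff a j hpos hg (v j) (w j)).1
      (congrArg Subtype.val (congrFun hvw j))
    have hlt : |v j - w j| < (((q - 1) / gcdCol q a j : ℕ) : ℤ) := by
      rw [abs_lt]
      constructor <;> linarith [(hv j).1, (hv j).2, (hw j).1, (hw j).2]
    exact sub_eq_zero.1 (Int.eq_zero_of_abs_lt_dvd hdvd hlt)
  · intro y hy
    choose t ht using fun j => (y j).2
    choose z hz using fun j => Subgroup.mem_zpowers_iff.1 (hgen (t j))
    have hperiod : ∀ j, (0 : ℤ) < ((q - 1) / gcdCol q a j : ℕ) := fun j =>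
      Int.natCast_pos.2 (Nat.div_pos (Nat.gcd_le_left _ hpos) (Nat.gcd_pos_of_pos_left _ hpos))
    let v : Fin n → ℤ := fun j => (z j - 1) % ((q - 1) / gcdCol q a j : ℕ) + 1
    have hv : (fun j => (⟨psiHom K a j (g ^ v j), g ^ v j, rfl⟩ : YsubGroup K a j)) = y := by
      funext j
      refine Subtype.ext ?_
      rw [← ht j, ← hz j]
      refine (psiHom_zpow_eq_iff a j hpos hg (v j) (z j)).2 ?_
      have h := (Int.mod_modEq (z j - 1) ((q - 1) / gcdCol q a j : ℕ)).symm.dvd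
      convert h using 1
      simp only [v]
      ring
    refine ⟨v, ⟨fun j => ⟨?_, ?_⟩, ?_⟩, hv⟩
    · linarith [Int.emod_nonneg (z j - 1) (hperiod j).ne']
    · linarith [Int.emod_lt_of_pos (z j - 1) (hperiod j)]
    · rw [hcast]
      exact (psiHom_zpow_mem_ker_iff a g v).1 (hv ▸ hy)
end
end

section
/- If there is a positive integer α with ∑_{j=1}^n a_{ij} = α for every i = 1,…,m (i.e., the monomials parameterizing X all have the same degree α), then |X| ≤ (q−1)^{n−1}. -/
open Finset MvPolynomial

noncomputable section

theorem prod_zpow_const {ι G : Type*} [CommGroup G] (s : Finset ι) (g : G) (f : ι → ℤ) :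
    ∏ j ∈ s, g ^ f j = g ^ ∑ j ∈ s, f j := by
  classical
  induction s using Finset.induction_on with
  | empty => simp
  | insert j s hj ih => rw [Finset.prod_insert hj, Finset.sum_insert hj, ih, zpow_add]

/-- If all rows of `a` have the same sum, then every row of `bmat a` sums to zero. -/
theorem sum_bmat_eq_zero {m n : ℕ} [NeZero m] (a : Fin m → Fin n → ℕ) (α : ℕ)
    (hsum : ∀ i : Fin m, ∑ j, a i j = α) (i : Fin m) : ∑ j, bmat a i j = 0 := by
  simp only [bmat, Finset.sum_sub_distrib]
  rw [← Nat.cast_sum, ← Nat.cast_sum, hsum, hsum, sub_self]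

/-- If all rows of `a` have the same sum, then the first parameter of the toric set can be
normalized to `1`. -/
theorem toricSet_subset_range {m k : ℕ} [NeZero m] (K : Type) [Field K]
    (a : Fin m → Fin (k + 1) → ℕ) (α : ℕ) (hsum : ∀ i : Fin m, ∑ j, a i j = α) :
    toricSet K a ⊆
      Set.range fun (s : Fin k → Kˣ) (i : Fin m) => ∏ j, s j ^ bmat a i j.succ := by
  rintro x ⟨t, ht⟩
  refine ⟨fun j => t j.succ / t 0, funext fun i => ?_⟩
  have hdiv : ∏ j, (t j / t 0) ^ bmat a i j = x i := by
    simp only [div_zpow, Finset.prod_div_distrib]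
    rw [prod_zpow_const, sum_bmat_eq_zero a α hsum, zpow_zero, div_one, ht]
  rw [← hdiv, Fin.prod_univ_succ, div_self', one_zpow, one_mul]

/-- if all rows of `a` have the same sum `α > 0`, then `|X| ≤ (q-1)^{n-1}`. -/
theorem stmt4 {q m n : ℕ} (hq : IsPrimePow q) (hm : 2 ≤ m) (hn : 1 ≤ n) [NeZero m]
    (K : Type) [Field K] [Fintype K] (hK : Fintype.card K = q)
    (a : Fin m → Fin n → ℕ) (α : ℕ) (hα : 0 < α)
    (hsum : ∀ i : Fin m, ∑ j, a i j = α) :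
    (toricSet K a).ncard ≤ (q - 1) ^ (n - 1) := by
  classical
  obtain ⟨k, rfl⟩ : ∃ k, n = k + 1 := ⟨n - 1, by omega⟩
  calc (toricSet K a).ncard
      ≤ (Set.range fun (s : Fin k → Kˣ) (i : Fin m) => ∏ j, s j ^ bmat a i j.succ).ncard :=
        Set.ncard_le_ncard (toricSet_subset_range K a α hsum) (Set.finite_range _)
    _ ≤ Nat.card (Fin k → Kˣ) := by
        rw [← Set.image_univ, ← Set.ncard_univ]
        exact Set.ncard_image_le Set.finite_univ
    _ = (q - 1) ^ (k + 1 - 1) := by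
        simp [Nat.card_eq_fintype_card, Fintype.card_units, hK]
end
end

section
/- If q is odd and the graph G is disconnected, then |X| < (q−1)^{n−1}. -/
open Finset MvPolynomial

noncomputable section

/-- The monomial parametrization of the toric set, as a group homomorphism. -/
def toricHom (K : Type) [Field K] {m n : ℕ} [NeZero m] (a : Fin m → Fin n → ℕ) :
    (Fin n → Kˣ) →* (Fin m → Kˣ) where
  toFun t i := ∏ j, t j ^ bmat a i j
  map_one' := by ext; simp
  map_mul' s t := by ext; simp [mul_zpow, Finset.prod_mul_distrib]

theorem toricSet_eq_range (K : Type) [Field K] {m n : ℕ} [NeZero m] (a : Fin m → Fin n → ℕ) :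
    toricSet K a = ((toricHom K a).range : Set (Fin m → Kˣ)) := by
  ext x
  constructor
  · rintro ⟨t, ht⟩
    exact ⟨t, funext fun i => (ht i).symm⟩
  · rintro ⟨t, rfl⟩
    exact ⟨t, fun _ => rfl⟩

theorem prod_pow_incidence {M : Type*} [CommMonoid M] {n : ℕ} (t : Fin n → M) {x y : Fin n}
    (hxy : x ≠ y) : ∏ j, t j ^ (if j ∈ s(x, y) then 1 else 0) = t x * t y := by
  rw [← Finset.prod_pair hxy, ← Finset.prod_subset (Finset.subset_univ {x, y})]
  · exact Finset.prod_congr rfl fun j hj => by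
      rw [if_pos (by simpa using hj), pow_one]
  · intro j _ hj
    rw [if_neg (by simpa using hj), pow_zero]

/-- A vector whose products over the edges all agree lies in the kernel of the parametrization. -/
theorem mem_ker_toricHom (K : Type) [Field K] {m n : ℕ} [NeZero m] (G : SimpleGraph (Fin n))
    (e : Fin m ≃ G.edgeSet) (a : Fin m → Fin n → ℕ)
    (hA : ∀ i j, a i j = if j ∈ (e i : Sym2 (Fin n)) then 1 else 0) (t : Fin n → Kˣ) (c : Kˣ)
    (ht : ∀ x y, G.Adj x y → t x * t y = c) : t ∈ (toricHom K a).ker := by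
  have hc : ∀ i, ∏ j, t j ^ a i j = c := by
    intro i
    simp only [hA]
    obtain ⟨p, hp⟩ := e i
    induction p with
    | _ x y => rw [prod_pow_incidence t (G.ne_of_adj hp), ht x y hp]
  rw [MonoidHom.mem_ker]
  funext i
  change ∏ j, t j ^ bmat a i j = 1
  simp only [bmat, zpow_sub, zpow_natCast, Finset.prod_mul_distrib, Finset.prod_inv_distrib, hc,
    mul_inv_cancel]

/-- if `q` is odd and the graph `G` is disconnected, then
`|X| < (q-1)^{n-1}`. -/
theorem stmt6 {q m n : ℕ} (hq : IsPrimePow q) (hodd : Odd q) (hm : 1 ≤ m) (hn : 2 ≤ n) [NeZero m]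
    (K : Type) [Field K] [Fintype K] (hK : Fintype.card K = q)
    (G : SimpleGraph (Fin n)) (e : Fin m ≃ G.edgeSet)
    (a : Fin m → Fin n → ℕ)
    (hA : ∀ i j, a i j = if j ∈ (e i : Sym2 (Fin n)) then 1 else 0)
    (hdisc : ¬ G.Connected) :
    (toricSet K a).ncard < (q - 1) ^ (n - 1) := by
  classical
  have : Nonempty (Fin n) := ⟨⟨0, by omega⟩⟩
  obtain ⟨u, v, huv⟩ : ∃ u v, ¬ G.Reachable u v := by
    by_contra! h
    exact hdisc ⟨h⟩
  have hneg : (-1 : Kˣ) ≠ 1 := by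
    intro h
    have h2 : ringChar K ≠ 2 := fun h2 => by
      have := FiniteField.even_card_iff_char_two.1 h2
      rw [hK] at this
      have := Nat.odd_iff.1 hodd
      omega
    exact Ring.neg_one_ne_one_of_char_ne_two h2 (by simpa using congrArg Units.val h)
  have hunits : Nat.card Kˣ = q - 1 := by
    rw [Nat.card_units, Nat.card_eq_fintype_card, hK]
  let const : Kˣ → (toricHom K a).ker := fun c =>
    ⟨fun _ => c, mem_ker_toricHom K G e a hA _ (c * c) fun _ _ _ => rfl⟩
  have hinj : Function.Injective const := fun c d h =>
    congrFun (congrArg Subtype.val h) u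
  have hsurj : ¬ Function.Surjective const := by
    intro h
    obtain ⟨c, hc⟩ := h ⟨fun j => if G.Reachable u j then -1 else 1, by
      refine mem_ker_toricHom K G e a hA _ 1 fun x y hxy => ?_
      have hiff : G.Reachable u x ↔ G.Reachable u y :=
        ⟨fun h => h.trans hxy.reachable, fun h => h.trans hxy.symm.reachable⟩
      by_cases hy : G.Reachable u y <;> simp [hiff, hy]⟩
    have hu : c = -1 := by simpa [const] using congrFun (congrArg Subtype.val hc) u
    have hv : c = 1 := by simpa [const, huv] using congrFun (congrArg Subtype.val hc) v
    exact hneg (hu.symm.trans hv)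
  have hker : q - 1 < Nat.card (toricHom K a).ker := by
    rw [← hunits, Nat.card_eq_fintype_card, Nat.card_eq_fintype_card]
    exact Fintype.card_lt_of_injective_not_surjective _ hinj hsurj
  have hcard : Nat.card (toricHom K a).ker * Nat.card (toricHom K a).range = (q - 1) ^ n := by
    rw [← Subgroup.index_ker, Subgroup.card_mul_index, Nat.card_fun, hunits, Nat.card_fin]
  have hX : (toricSet K a).ncard = Nat.card (toricHom K a).range := by
    rw [toricSet_eq_range, ← Nat.card_coe_set_eq]
    rfl
  have hpos : 0 < Nat.card (toricHom K a).range := Nat.card_pos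
  rw [hX]
  refine Nat.lt_of_mul_lt_mul_left (a := q - 1) ?_
  calc (q - 1) * Nat.card (toricHom K a).range
      < Nat.card (toricHom K a).ker * Nat.card (toricHom K a).range :=
        Nat.mul_lt_mul_of_pos_right hker hpos
    _ = (q - 1) * (q - 1) ^ (n - 1) := by
        rw [hcard, ← pow_succ', Nat.sub_add_cancel (by omega)]
end
end

section
/- For every d ≥ (m−1)(q−2) one has H_X(d) = |X| (equivalently, the evaluation map ev_d is surjective onto K^X, so C_X(d) = K^{|X|}); in particular the regularity index r_X of X satisfies r_X ≤ (m−1)(q−2). -/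
open Finset MvPolynomial

noncomputable section

/-- The product of the linear forms `X_i - c X_0` over `i ≠ 0` and `c ≠ P_i`, which vanishes at
every point of the projective torus other than `P`. -/
def separatingForm (K : Type) [Field K] [Fintype K] [DecidableEq K] {m : ℕ} [NeZero m]
    (P : Fin m → Kˣ) : MvPolynomial (Fin m) K :=
  ∏ i ∈ univ.erase 0, ∏ c ∈ univ.erase (P i), (X i - C (c : K) * X 0)

section Torus

variable {K : Type} [Field K] [Fintype K] [DecidableEq K] {m : ℕ} [NeZero m]

theorem separatingForm_isHomogeneous (P : Fin m → Kˣ) :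
    (separatingForm K P).IsHomogeneous ((m - 1) * (Fintype.card K - 2)) := by
  have hdeg : ∑ _i ∈ (univ.erase 0 : Finset (Fin m)), (Fintype.card K - 2)
      = (m - 1) * (Fintype.card K - 2) := by
    simp [Finset.card_erase_of_mem]
  rw [← hdeg]
  refine IsHomogeneous.prod _ _ _ fun i _ => ?_
  have hcard : ∑ _c ∈ univ.erase (P i), 1 = Fintype.card K - 2 := by
    simp [Finset.card_erase_of_mem, Fintype.card_units, Nat.sub_sub]
  rw [← hcard]
  refine IsHomogeneous.prod _ _ _ fun c _ => (isHomogeneous_X K i).sub ?_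
  simpa using (isHomogeneous_C (Fin m) (c : K)).mul (isHomogeneous_X K 0)

theorem eval_separatingForm_self {P : Fin m → Kˣ} (hP : P ∈ projTorus K m) :
    eval (fun i => (P i : K)) (separatingForm K P) ≠ 0 := by
  have hP0 : P 0 = 1 := hP
  simp only [separatingForm, map_prod, prod_ne_zero_iff]
  intro i _ c hc
  simpa [hP0, sub_eq_zero, Units.val_inj, eq_comm] using hc

theorem eval_separatingForm_of_ne {P Q : Fin m → Kˣ} (hP : P ∈ projTorus K m)
    (hQ : Q ∈ projTorus K m) (hne : Q ≠ P) :
    eval (fun i => (Q i : K)) (separatingForm K P) = 0 := by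
  have hP0 : P 0 = 1 := hP
  have hQ0 : Q 0 = 1 := hQ
  obtain ⟨i, hi⟩ := Function.ne_iff.mp hne
  have hi0 : i ≠ 0 := by
    rintro rfl
    exact hi (hQ0.trans hP0.symm)
  simp only [separatingForm, map_prod]
  refine prod_eq_zero (i := i) (by simpa using hi0) (prod_eq_zero (i := Q i) (by simpa using hi) ?_)
  simp [hQ0]

theorem single_mem_evalCode {Z : Set (Fin m → Kˣ)} [DecidableEq Z] (hZ : Z ⊆ projTorus K m) {d : ℕ}
    (hd : (m - 1) * (Fintype.card K - 2) ≤ d) (P : Z) :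
    Pi.single P (1 : K) ∈ evalCode K Z d := by
  have hself := eval_separatingForm_self (hZ P.2)
  refine ⟨C (eval (fun i => ((P : Fin m → Kˣ) i : K)) (separatingForm K P.1))⁻¹ *
    (separatingForm K P.1 * X 0 ^ (d - (m - 1) * (Fintype.card K - 2))), ?_, ?_⟩
  · have h := (isHomogeneous_C (Fin m)
        (eval (fun i => ((P : Fin m → Kˣ) i : K)) (separatingForm K P.1))⁻¹).mul
      ((separatingForm_isHomogeneous P.1).mul
        (isHomogeneous_X_pow (R := K) (0 : Fin m) (d - (m - 1) * (Fintype.card K - 2))))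
    rwa [Nat.add_sub_cancel' hd, zero_add] at h
  · funext Q
    have hQ0 : (Q : Fin m → Kˣ) 0 = 1 := hZ Q.2
    by_cases h : Q = P
    · subst h
      simp [evLM, hQ0, inv_mul_cancel₀ hself]
    · have hne : (Q : Fin m → Kˣ) ≠ P := fun h' => h (Subtype.ext h')
      simp [evLM, hQ0, h, eval_separatingForm_of_ne (hZ P.2) (hZ Q.2) hne]

theorem evalCode_eq_top {Z : Set (Fin m → Kˣ)} (hZ : Z ⊆ projTorus K m) {d : ℕ}
    (hd : (m - 1) * (Fintype.card K - 2) ≤ d) : evalCode K Z d = ⊤ := by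
  classical
  have : Fintype Z := Fintype.ofFinite Z
  refine eq_top_iff.mpr fun v _ => ?_
  rw [pi_eq_sum_univ' v]
  refine Submodule.sum_mem _ fun P _ => Submodule.smul_mem _ _ ?_
  convert single_mem_evalCode hZ hd P using 1

theorem hilbF_eq_ncard {Z : Set (Fin m → Kˣ)} (hZ : Z ⊆ projTorus K m) {d : ℕ}
    (hd : (m - 1) * (Fintype.card K - 2) ≤ d) : hilbF K Z d = Z.ncard := by
  classical
  have : Fintype Z := Fintype.ofFinite Z
  rw [hilbF, evalCode_eq_top hZ hd, finrank_top, Module.finrank_fintype_fun_eq_card,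
    Set.ncard_eq_toFinset_card', Set.toFinset_card]

end Torus

theorem toricSet_subset_projTorus (K : Type) [Field K] {m n : ℕ} [NeZero m]
    (a : Fin m → Fin n → ℕ) : toricSet K a ⊆ projTorus K m := by
  rintro x ⟨t, ht⟩
  simp [projTorus, ht, bmat]

/-- `H_X(d) = |X|` for every `d ≥ (m-1)(q-2)`; in particular
`r_X ≤ (m-1)(q-2)`. -/
theorem stmt10 {q m n : ℕ} (hq : IsPrimePow q) (hm : 2 ≤ m) (hn : 1 ≤ n) [NeZero m]
    (K : Type) [Field K] [Fintype K] (hK : Fintype.card K = q)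
    (a : Fin m → Fin n → ℕ) :
    (∀ d, (m - 1) * (q - 2) ≤ d → hilbF K (toricSet K a) d = (toricSet K a).ncard) ∧
    regIndex K (toricSet K a) ≤ (m - 1) * (q - 2) := by
  classical
  subst hK
  have h : ∀ d, (m - 1) * (Fintype.card K - 2) ≤ d →
      hilbF K (toricSet K a) d = (toricSet K a).ncard :=
    fun _ hd => hilbF_eq_ncard (toricSet_subset_projTorus K a) hd
  exact ⟨h, Nat.sInf_le h⟩
end
end

section
/- Suppose X is a proper subset of the projective torus T_{m−1} and set Y = T_{m−1} ∖ X. Then for every d with 0 ≤ d < (m−1)(q−2), the minimum distances satisfy δ_{T_{m−1}}(d) ≥ δ_X(d) + δ_Y(d); equivalently, δ_X(d) ≤ δ_{T_{m−1}}(d) − δ_Y(d). -/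
open Finset MvPolynomial

noncomputable section

/-- The functions on the torus `(K*)^s` given by polynomials of degree at most `d`. -/
def torusPoly (K : Type) [Field K] (s d : ℕ) : Submodule K ((Fin s → Kˣ) → K) :=
  Submodule.span K {f | ∃ e : Fin s → ℕ, ∑ i, e i ≤ d ∧ f = fun x => ∏ i, (x i : K) ^ e i}

/-- The least weight of a nonzero function in `torusPoly K s d`. -/
def torusDist (K : Type) [Field K] (s d : ℕ) : ℕ :=
  sInf {w | ∃ v ∈ torusPoly K s d, v ≠ 0 ∧ wt v = w}

section TorusPoly

variable {K : Type} [Field K] {s d : ℕ}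

lemma monomial_mem_torusPoly (e : Fin s → ℕ) (he : ∑ i, e i ≤ d) :
    (fun x : Fin s → Kˣ => ∏ i, (x i : K) ^ e i) ∈ torusPoly K s d :=
  Submodule.subset_span ⟨e, he, rfl⟩

lemma torusPoly_le_comap {t d' : ℕ} (L : ((Fin s → Kˣ) → K) →ₗ[K] ((Fin t → Kˣ) → K))
    (hL : ∀ e : Fin s → ℕ, ∑ i, e i ≤ d →
      L (fun x => ∏ i, (x i : K) ^ e i) ∈ torusPoly K t d')
    {f : (Fin s → Kˣ) → K} (hf : f ∈ torusPoly K s d) : L f ∈ torusPoly K t d' := by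
  have : torusPoly K s d ≤ (torusPoly K t d').comap L := by
    refine Submodule.span_le.2 ?_
    rintro _ ⟨e, he, rfl⟩
    exact hL e he
  exact this hf

lemma one_mem_torusPoly : (fun _ : Fin s → Kˣ => (1 : K)) ∈ torusPoly K s d := by
  simpa using monomial_mem_torusPoly (K := K) (d := d) (fun _ : Fin s => 0) (by simp)

lemma torusPoly_mono {d' : ℕ} (h : d ≤ d') : torusPoly K s d ≤ torusPoly K s d' :=
  Submodule.span_mono fun _ ⟨e, he, hf⟩ => ⟨e, he.trans h, hf⟩

lemma coord_mul_mem_torusPoly {f : (Fin s → Kˣ) → K} (hf : f ∈ torusPoly K s d) (i : Fin s) :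
    (fun x => (x i : K) * f x) ∈ torusPoly K s (d + 1) := by
  refine torusPoly_le_comap (LinearMap.mulLeft K fun x : Fin s → Kˣ => (x i : K))
    (fun e he => ?_) hf
  convert monomial_mem_torusPoly (K := K) (d := d + 1) (e + Pi.single i 1) ?_ using 1
  · funext x
    have : ∏ k, (x k : K) ^ (Pi.single i 1 : Fin s → ℕ) k = x i := by simp [Pi.single_apply]
    simp only [LinearMap.mulLeft_apply, Pi.mul_apply, Pi.add_apply, pow_add,
      Finset.prod_mul_distrib, this, mul_comm]
  · simp [Finset.sum_add_distrib, he]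

lemma coord_sub_mul_mem_torusPoly {f : (Fin s → Kˣ) → K} (hf : f ∈ torusPoly K s d) (i : Fin s)
    (a : K) : (fun x => ((x i : K) - a) * f x) ∈ torusPoly K s (d + 1) := by
  have := sub_mem (coord_mul_mem_torusPoly hf i)
    (Submodule.smul_mem _ a (torusPoly_mono (Nat.le_succ d) hf))
  convert this using 1
  funext x
  simp [sub_mul]

lemma prod_coord_sub_mul_mem_torusPoly {f : (Fin s → Kˣ) → K} (hf : f ∈ torusPoly K s d)
    (i : Fin s) (A : Finset Kˣ) :
    (fun x => (∏ a ∈ A, ((x i : K) - a)) * f x) ∈ torusPoly K s (d + #A) := by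
  classical
  induction A using Finset.induction_on with
  | empty => simpa using hf
  | insert a A ha ih =>
    rw [Finset.card_insert_of_notMem ha, ← add_assoc]
    convert coord_sub_mul_mem_torusPoly ih i a using 1
    funext x
    rw [Finset.prod_insert ha, mul_assoc]

lemma comp_succAbove_mem_torusPoly {f : (Fin s → Kˣ) → K} (hf : f ∈ torusPoly K s d)
    (i : Fin (s + 1)) :
    (fun x : Fin (s + 1) → Kˣ => f (i.removeNth x)) ∈ torusPoly K (s + 1) d := by
  refine torusPoly_le_comap (LinearMap.funLeft K K fun x : Fin (s + 1) → Kˣ => i.removeNth x)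
    (fun e he => ?_) hf
  convert monomial_mem_torusPoly (K := K) (d := d) (i.insertNth 0 e : Fin (s + 1) → ℕ) ?_ using 1
  · funext x
    simp [LinearMap.funLeft, Fin.prod_univ_succAbove _ i, Fin.removeNth]
  · simpa [Fin.sum_univ_succAbove _ i] using he

lemma insertNth_slice_mem_torusPoly {f : (Fin (s + 1) → Kˣ) → K} (hf : f ∈ torusPoly K (s + 1) d)
    (i : Fin (s + 1)) (a : Kˣ) :
    (fun y : Fin s → Kˣ => f (i.insertNth a y)) ∈ torusPoly K s d := by
  refine torusPoly_le_comap
    (LinearMap.funLeft K K fun y : Fin s → Kˣ => (i.insertNth a y : Fin (s + 1) → Kˣ))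
    (fun e he => ?_) hf
  have h : ∑ j, (i.removeNth e : Fin s → ℕ) j ≤ d := by
    rw [Fin.sum_univ_succAbove _ i] at he
    exact (Nat.le_add_left _ _).trans he
  convert Submodule.smul_mem _ ((a : K) ^ e i) (monomial_mem_torusPoly (K := K) _ h) using 1
  funext y
  simp [LinearMap.funLeft, Fin.prod_univ_succAbove _ i, Fin.removeNth]

lemma translate_mem_torusPoly {f : (Fin s → Kˣ) → K} (hf : f ∈ torusPoly K s d)
    (p : Fin s → Kˣ) : (fun y => f (y * p)) ∈ torusPoly K s d := by
  refine torusPoly_le_comap (LinearMap.funLeft K K fun y : Fin s → Kˣ => y * p)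
    (fun e he => ?_) hf
  convert Submodule.smul_mem _ (∏ i, (p i : K) ^ e i) (monomial_mem_torusPoly (K := K) e he)
    using 1
  funext y
  simp [LinearMap.funLeft, mul_pow, Finset.prod_mul_distrib, mul_comm]

/-- Subtracting a slice leaves a multiple of the corresponding linear form. -/
lemma exists_sub_slice_eq_mul (i : Fin (s + 1)) (a : Kˣ) {f : (Fin (s + 1) → Kˣ) → K}
    (hf : f ∈ torusPoly K (s + 1) d) :
    ∃ g : (Fin (s + 1) → Kˣ) → K, (∀ x, f x - f (i.insertNth a (i.removeNth x)) =
      ((x i : K) - a) * g x) ∧ (d = 0 → g = 0) ∧ g ∈ torusPoly K (s + 1) (d - 1) := by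
  induction hf using Submodule.span_induction with
  | mem f hf =>
    obtain ⟨e, he, rfl⟩ := hf
    have hsum := Fin.sum_univ_succAbove e i
    refine ⟨fun x => (∑ k ∈ range (e i), (x i : K) ^ k * (a : K) ^ (e i - 1 - k)) *
      ∏ j, (x (i.succAbove j) : K) ^ e (i.succAbove j), fun x => ?_, fun hd => ?_, ?_⟩
    · simp only [Fin.prod_univ_succAbove _ i, Fin.insertNth_apply_same,
        Fin.insertNth_apply_succAbove, Fin.removeNth]
      rw [← mul_assoc, mul_comm ((x i : K) - a), (Commute.all (x i : K) (a : K)).geom_sum₂_mul,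
        sub_mul]
    · have : e i = 0 := by omega
      funext x
      simp [this]
    · have : (fun x : Fin (s + 1) → Kˣ =>
          (∑ k ∈ range (e i), (x i : K) ^ k * (a : K) ^ (e i - 1 - k)) *
          ∏ j, (x (i.succAbove j) : K) ^ e (i.succAbove j)) =
          ∑ k ∈ range (e i), (a : K) ^ (e i - 1 - k) • fun x : Fin (s + 1) → Kˣ =>
            ∏ j, (x j : K) ^ (i.insertNth k (i.removeNth e) : Fin (s + 1) → ℕ) j := by
        funext x
        simp [Fin.prod_univ_succAbove _ i, Finset.sum_mul, mul_left_comm, mul_assoc]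
      rw [this]
      refine sum_mem fun k hk => Submodule.smul_mem _ _ (monomial_mem_torusPoly _ ?_)
      have hk := Finset.mem_range.1 hk
      simp only [Fin.sum_univ_succAbove _ i, Fin.insertNth_apply_same,
        Fin.insertNth_apply_succAbove, Fin.removeNth]
      omega
  | zero => exact ⟨0, by simp, fun _ => rfl, zero_mem _⟩
  | add f₁ f₂ _ _ h₁ h₂ =>
    obtain ⟨g₁, e₁, z₁, m₁⟩ := h₁
    obtain ⟨g₂, e₂, z₂, m₂⟩ := h₂
    refine ⟨g₁ + g₂, fun x => ?_, fun h => by simp [z₁ h, z₂ h], add_mem m₁ m₂⟩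
    simp only [Pi.add_apply]
    linear_combination e₁ x + e₂ x
  | smul c f _ h =>
    obtain ⟨g, e, z, m⟩ := h
    refine ⟨c • g, fun x => ?_, fun h => by simp [z h], Submodule.smul_mem _ _ m⟩
    simp only [Pi.smul_apply, smul_eq_mul]
    linear_combination c * e x

/-- A nonzero function vanishing on the slices `x i = a`, `a ∈ A`, is divisible by
`∏ a ∈ A, (x i - a)`. -/
lemma exists_eq_prod_mul_of_slices_eq_zero (i : Fin (s + 1)) {f : (Fin (s + 1) → Kˣ) → K}
    (hf : f ∈ torusPoly K (s + 1) d) (hf0 : f ≠ 0) (A : Finset Kˣ)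
    (hA : ∀ a ∈ A, ∀ y : Fin s → Kˣ, f (i.insertNth a y) = 0) :
    #A ≤ d ∧ ∃ g ∈ torusPoly K (s + 1) (d - #A),
      ∀ x, f x = (∏ a ∈ A, ((x i : K) - a)) * g x := by
  classical
  induction A using Finset.induction_on with
  | empty => exact ⟨Nat.zero_le _, f, by simpa using hf, by simp⟩
  | insert a A ha ih =>
    obtain ⟨hAd, g, hg, hfg⟩ := ih fun b hb => hA b (Finset.mem_insert_of_mem hb)
    obtain ⟨k, hk, hk0, hkm⟩ := exists_sub_slice_eq_mul i a hg
    have hslice : ∀ y : Fin s → Kˣ, g (i.insertNth a y) = 0 := by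
      intro y
      have h := hA a (Finset.mem_insert_self _ _) y
      rw [hfg, Fin.insertNth_apply_same] at h
      refine (mul_eq_zero.1 h).resolve_left (Finset.prod_ne_zero_iff.2 fun b hb => ?_)
      rw [sub_ne_zero]
      intro hab
      exact ha (Units.ext hab ▸ hb)
    have hgk : ∀ x, g x = ((x i : K) - a) * k x := fun x => by
      rw [← hk x, hslice, sub_zero]
    have hlt : #A < d := by
      by_contra hlt
      refine hf0 (funext fun x => ?_)
      rw [hfg, hgk, hk0 (by omega)]
      simp
    rw [Finset.card_insert_of_notMem ha]
    refine ⟨hlt, k, by rwa [Nat.sub_sub] at hkm, fun x => ?_⟩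
    rw [hfg, hgk, Finset.prod_insert ha]
    ring

lemma torusDist_le {v : (Fin s → Kˣ) → K} (hv : v ∈ torusPoly K s d) (h0 : v ≠ 0) :
    torusDist K s d ≤ wt v :=
  Nat.sInf_le ⟨v, hv, h0, rfl⟩

lemma exists_wt_eq_torusDist (K : Type) [Field K] (s d : ℕ) :
    ∃ v ∈ torusPoly K s d, v ≠ 0 ∧ wt v = torusDist K s d :=
  Nat.sInf_mem (s := {w | ∃ v ∈ torusPoly K s d, v ≠ 0 ∧ wt v = w})
    ⟨_, _, one_mem_torusPoly, fun h => one_ne_zero (congrFun h 1), rfl⟩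

lemma wt_comp_equiv {ι κ : Type*} (e : ι ≃ κ) (v : κ → K) : wt (fun x => v (e x)) = wt v :=
  Set.ncard_preimage_of_injective_subset_range (s := {i | v i ≠ 0}) e.injective (by simp)

/-- A minimum weight function can be chosen not to vanish at the identity. -/
lemma exists_wt_eq_torusDist_of_one (K : Type) [Field K] (s d : ℕ) :
    ∃ v ∈ torusPoly K s d, v 1 ≠ 0 ∧ wt v = torusDist K s d := by
  obtain ⟨v, hv, h0, hw⟩ := exists_wt_eq_torusDist K s d
  obtain ⟨p, hp⟩ := Function.ne_iff.1 h0
  exact ⟨_, translate_mem_torusPoly hv p, by simpa using hp,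
    (wt_comp_equiv (Equiv.mulRight p) v).trans hw⟩

variable [Fintype Kˣ]

lemma wt_eq_sum_slices (i : Fin (s + 1)) (v : (Fin (s + 1) → Kˣ) → K) :
    wt v = ∑ a : Kˣ, wt fun y : Fin s → Kˣ => v (i.insertNth a y) := by
  classical
  have key : ∀ {ι : Type} [Fintype ι] (u : ι → K), wt u = ∑ x, if u x ≠ 0 then 1 else 0 := by
    intro ι _ u
    rw [wt, Set.ncard_eq_toFinset_card', Finset.sum_boole]
    simp
  simp only [key]
  rw [← (Fin.insertNthEquiv (fun _ => Kˣ) i).sum_comp, Fintype.sum_prod_type]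
  rfl

/-- Multiplying by `#A` distinct linear forms in a new variable. -/
lemma wt_prod_coord_sub_mul (i : Fin (s + 1)) (A : Finset Kˣ) (g : (Fin s → Kˣ) → K) :
    wt (fun x : Fin (s + 1) → Kˣ => (∏ a ∈ A, ((x i : K) - a)) * g (i.removeNth x)) =
      (Fintype.card Kˣ - #A) * wt g := by
  classical
  rw [wt_eq_sum_slices i, ← Finset.card_compl, ← smul_eq_mul, ← Finset.sum_const,
    ← Finset.sum_add_sum_compl A, Finset.sum_eq_zero, zero_add]
  · refine Finset.sum_congr rfl fun b hb => ?_
    have : ∏ a ∈ A, ((b : K) - a) ≠ 0 := Finset.prod_ne_zero_iff.2 fun a ha => by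
      rw [sub_ne_zero]
      intro hab
      exact Finset.mem_compl.1 hb (Units.ext hab ▸ ha)
    simp [wt, this]
  · intro b hb
    have : ∏ a ∈ A, ((b : K) - a) = 0 := Finset.prod_eq_zero hb (sub_self _)
    simp [wt, this]

lemma exists_mul_torusDist_le (K : Type) [Field K] [Fintype Kˣ] (s d : ℕ) :
    ∃ j ≤ d, j < Fintype.card Kˣ ∧
      (Fintype.card Kˣ - j) * torusDist K s (d - j) ≤ torusDist K (s + 1) d := by
  classical
  obtain ⟨v, hv, h0, hw⟩ := exists_wt_eq_torusDist K (s + 1) d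
  set A : Finset Kˣ := {a | ∀ y : Fin s → Kˣ, v ((0 : Fin (s + 1)).insertNth a y) = 0} with hA
  obtain ⟨hd, g, hg, hvg⟩ := exists_eq_prod_mul_of_slices_eq_zero 0 hv h0 A (by simp [hA])
  refine ⟨#A, hd, ?_, ?_⟩
  · obtain ⟨p, hp⟩ := Function.ne_iff.1 h0
    refine Finset.card_lt_univ_of_notMem (x := p 0) fun hmem => hp ?_
    have := (Finset.mem_filter.1 hmem).2 ((0 : Fin (s + 1)).removeNth p)
    rwa [Fin.insertNth_self_removeNth] at this
  · rw [← hw, wt_eq_sum_slices 0, ← Finset.card_compl, ← smul_eq_mul, ← Finset.sum_const]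
    refine le_trans (Finset.sum_le_sum fun a ha => ?_)
      (Finset.sum_le_sum_of_subset (Finset.subset_univ Aᶜ))
    have hprod : ∏ b ∈ A, ((a : K) - b) ≠ 0 := Finset.prod_ne_zero_iff.2 fun b hb => by
      rw [sub_ne_zero]
      intro hab
      exact Finset.mem_compl.1 ha (Units.ext hab ▸ hb)
    have hwt : wt (fun y : Fin s → Kˣ => v ((0 : Fin (s + 1)).insertNth a y)) =
        wt fun y : Fin s → Kˣ => g ((0 : Fin (s + 1)).insertNth a y) := by
      simp only [wt, hvg, Fin.insertNth_apply_same, mul_ne_zero_iff, ne_eq, hprod,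
        not_false_eq_true, true_and]
    rw [hwt]
    refine torusDist_le (insertNth_slice_mem_torusPoly hg 0 a) fun hz => ?_
    refine Finset.mem_compl.1 ha (Finset.mem_filter.2 ⟨Finset.mem_univ _, fun y => ?_⟩)
    rw [hvg, congrFun hz y]
    simp

lemma torusDist_succ_le (K : Type) [Field K] [Fintype Kˣ] (s d j : ℕ)
    (hj : j < Fintype.card Kˣ) :
    torusDist K (s + 1) (d + j) ≤ (Fintype.card Kˣ - j) * torusDist K s d := by
  classical
  obtain ⟨g, hg, h0, hw⟩ := exists_wt_eq_torusDist_of_one K s d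
  obtain ⟨A, hA, rfl⟩ := Finset.exists_subset_card_eq
    (s := (Finset.univ.erase (1 : Kˣ))) (n := j)
    (by rw [Finset.card_erase_of_mem (Finset.mem_univ _), Finset.card_univ]; omega)
  rw [← hw, ← wt_prod_coord_sub_mul 0 A g]
  refine torusDist_le
    (prod_coord_sub_mul_mem_torusPoly (comp_succAbove_mem_torusPoly hg 0) 0 A) fun hz => ?_
  have := congrFun hz 1
  refine mul_ne_zero (Finset.prod_ne_zero_iff.2 fun a ha => ?_) h0 this
  rw [sub_ne_zero]
  intro hab
  exact (Finset.mem_erase.1 (hA ha)).1 (Units.ext hab).symm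

/-- Below the regularity index, the minimum distance is attained by a product in which the factor
in a single chosen variable has at least two nonzeros. -/
lemma exists_mul_torusDist_le_of_lt (hN : 2 ≤ Fintype.card Kˣ) :
    ∀ {s d : ℕ}, d < (s + 1) * (Fintype.card Kˣ - 1) →
      ∃ j ≤ d, j + 2 ≤ Fintype.card Kˣ ∧
        (Fintype.card Kˣ - j) * torusDist K s (d - j) ≤ torusDist K (s + 1) d := by
  intro s
  induction s with
  | zero =>
    intro d hd
    obtain ⟨j, hj, -, hle⟩ := exists_mul_torusDist_le K 0 d
    exact ⟨j, hj, by omega, hle⟩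
  | succ s ih =>
    intro d hd
    obtain ⟨j, hj, hjN, hle⟩ := exists_mul_torusDist_le K (s + 1) d
    by_cases hj2 : j + 2 ≤ Fintype.card Kˣ
    · exact ⟨j, hj, hj2, hle⟩
    obtain rfl : j = Fintype.card Kˣ - 1 := by omega
    rw [add_mul _ 1, one_mul] at hd
    obtain ⟨k, hk, hk2, hkle⟩ := ih (d := d - (Fintype.card Kˣ - 1)) (by omega)
    refine ⟨k, by omega, hk2, ?_⟩
    have h := torusDist_succ_le K s (d - (Fintype.card Kˣ - 1) - k) (Fintype.card Kˣ - 1)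
      (by omega)
    rw [show d - (Fintype.card Kˣ - 1) - k + (Fintype.card Kˣ - 1) = d - k by omega,
      show Fintype.card Kˣ - (Fintype.card Kˣ - 1) = 1 by omega, one_mul] at h
    rw [show Fintype.card Kˣ - (Fintype.card Kˣ - 1) = 1 by omega, one_mul] at hle
    exact (Nat.mul_le_mul_left _ h).trans (hkle.trans hle)

/-- A minimum weight function which is nonzero at `1` and at a prescribed second point on a
coordinate axis. -/
lemma exists_wt_le_torusDist_of_lt (hN : 2 ≤ Fintype.card Kˣ)
    (hd : d < (s + 1) * (Fintype.card Kˣ - 1)) (i : Fin (s + 1)) (z : Kˣ) :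
    ∃ v ∈ torusPoly K (s + 1) d, v 1 ≠ 0 ∧ v (Pi.mulSingle i z) ≠ 0 ∧
      wt v ≤ torusDist K (s + 1) d := by
  classical
  obtain ⟨j, hj, hj2, hle⟩ := exists_mul_torusDist_le_of_lt hN hd
  obtain ⟨g, hg, h0, hw⟩ := exists_wt_eq_torusDist_of_one K s (d - j)
  obtain ⟨A, hA, rfl⟩ := Finset.exists_subset_card_eq
    (s := ({1, z} : Finset Kˣ)ᶜ) (n := j)
    (by have := Finset.card_le_two (a := (1 : Kˣ)) (b := z); rw [Finset.card_compl]; omega)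
  have hprod : ∀ b ∈ ({1, z} : Finset Kˣ), ∏ a ∈ A, ((b : K) - a) ≠ 0 := fun b hb =>
    Finset.prod_ne_zero_iff.2 fun a ha => by
      rw [sub_ne_zero]
      intro hab
      exact Finset.mem_compl.1 (hA ha) (Units.ext hab ▸ hb)
  have hmem := prod_coord_sub_mul_mem_torusPoly (comp_succAbove_mem_torusPoly hg i) i A
  rw [Nat.sub_add_cancel hj] at hmem
  refine ⟨_, hmem, mul_ne_zero (hprod 1 (by simp)) h0, mul_ne_zero ?_ ?_, ?_⟩
  · simpa using hprod z (by simp)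
  · convert h0 using 2
    funext k
    simp [Fin.removeNth]
  · rwa [wt_prod_coord_sub_mul, hw]

end TorusPoly

section Homogenization

variable {K : Type} [Field K] {s d : ℕ}

lemma IsHomogeneous.dehomogenize_mem_torusPoly {F : MvPolynomial (Fin (s + 1)) K}
    (hF : F.IsHomogeneous d) :
    (fun y : Fin s → Kˣ => eval (fun i => ((Fin.cons 1 y : Fin (s + 1) → Kˣ) i : K)) F) ∈
      torusPoly K s d := by
  have : (fun y : Fin s → Kˣ => eval (fun i => ((Fin.cons 1 y : Fin (s + 1) → Kˣ) i : K)) F) =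
      ∑ e ∈ F.support, F.coeff e • fun y : Fin s → Kˣ => ∏ i, (y i : K) ^ e i.succ := by
    funext y
    simp [eval_eq', Fin.prod_univ_succ]
  rw [this]
  refine sum_mem fun e he => Submodule.smul_mem _ _
    (monomial_mem_torusPoly (fun i : Fin s => e i.succ) ?_)
  have h := hF (mem_support_iff.1 he)
  replace h : e.degree = d := by rw [Finsupp.degree_eq_weight_one]; exact h
  rw [Finsupp.degree_eq_sum, Fin.sum_univ_succ] at h
  omega

lemma exists_homogeneous_of_mem_torusPoly {f : (Fin s → Kˣ) → K} (hf : f ∈ torusPoly K s d) :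
    ∃ F ∈ homogeneousSubmodule (Fin (s + 1)) K d, ∀ y : Fin s → Kˣ,
      eval (fun i => ((Fin.cons 1 y : Fin (s + 1) → Kˣ) i : K)) F = f y := by
  induction hf using Submodule.span_induction with
  | mem f hf =>
    obtain ⟨e, he, rfl⟩ := hf
    refine ⟨X 0 ^ (d - ∑ i, e i) * ∏ i, X i.succ ^ e i, ?_, fun y => ?_⟩
    · rw [mem_homogeneousSubmodule]
      have h := (isHomogeneous_X_pow (R := K) (0 : Fin (s + 1)) (d - ∑ i, e i)).mul
        (IsHomogeneous.prod Finset.univ (fun i : Fin s => (X i.succ : MvPolynomial _ K) ^ e i) e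
          fun i _ => isHomogeneous_X_pow _ _)
      rwa [Nat.sub_add_cancel he] at h
    · simp
  | zero => exact ⟨0, zero_mem _, by simp⟩
  | add f₁ f₂ _ _ h₁ h₂ =>
    obtain ⟨F₁, m₁, e₁⟩ := h₁
    obtain ⟨F₂, m₂, e₂⟩ := h₂
    exact ⟨F₁ + F₂, add_mem m₁ m₂, fun y => by simp [e₁, e₂]⟩
  | smul c f _ h =>
    obtain ⟨F, m, e⟩ := h
    exact ⟨c • F, Submodule.smul_mem _ _ m, fun y => by simp [e, smul_eval]⟩

lemma wt_evLM {m : ℕ} [NeZero m] (Z : Set (Fin m → Kˣ)) (F : MvPolynomial (Fin m) K) :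
    wt (evLM K Z d F) = {x | x ∈ Z ∧ eval (fun i => (x i : K)) F ≠ 0}.ncard := by
  rw [wt, ← Set.ncard_image_of_injective _ Subtype.val_injective]
  congr 1
  ext x
  simp [evLM, and_comm]

lemma wt_evLM_projTorus (F : MvPolynomial (Fin (s + 1)) K) :
    wt (evLM K (projTorus K (s + 1)) d F) =
      wt fun y : Fin s → Kˣ => eval (fun i => ((Fin.cons 1 y : Fin (s + 1) → Kˣ) i : K)) F := by
  rw [wt_evLM, wt, ← Set.ncard_image_of_injective _
    (Fin.cons_right_injective (α := fun _ : Fin (s + 1) => Kˣ) 1)]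
  congr 1
  ext x
  constructor
  · rintro ⟨hx, hF⟩
    have hx : x 0 = 1 := hx
    have hc : (Fin.cons 1 (Fin.tail x) : Fin (s + 1) → Kˣ) = x := by
      rw [← hx, Fin.cons_self_tail]
    exact ⟨Fin.tail x, by simpa only [Set.mem_ofPred_eq, hc] using hF, hc⟩
  · rintro ⟨y, hy, rfl⟩
    exact ⟨rfl, hy⟩

lemma minDist_le_wt_evLM {m : ℕ} [NeZero m] {Z : Set (Fin m → Kˣ)} {F : MvPolynomial (Fin m) K}
    (hF : F ∈ homogeneousSubmodule (Fin m) K d) {x : Fin m → Kˣ} (hx : x ∈ Z)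
    (h : eval (fun i => (x i : K)) F ≠ 0) : minDist K Z d ≤ wt (evLM K Z d F) := by
  refine Nat.sInf_le ⟨_, Submodule.mem_map_of_mem hF, fun h0 => h ?_, rfl⟩
  simpa [evLM] using congrFun h0 ⟨x, hx⟩

lemma torusDist_le_minDist_projTorus (K : Type) [Field K] (s d : ℕ) :
    torusDist K s d ≤ minDist K (projTorus K (s + 1)) d := by
  refine le_csInf ?_ ?_
  · obtain ⟨F, hF, hF1⟩ := exists_homogeneous_of_mem_torusPoly
      (one_mem_torusPoly (K := K) (s := s) (d := d))
    refine ⟨_, _, Submodule.mem_map_of_mem hF, fun h0 => ?_, rfl⟩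
    have h := congrFun h0 ⟨Fin.cons 1 1, rfl⟩
    simp [evLM, hF1] at h
  · rintro _ ⟨_, ⟨F, hF, rfl⟩, h0, rfl⟩
    rw [wt_evLM_projTorus]
    refine torusDist_le (IsHomogeneous.dehomogenize_mem_torusPoly hF) fun hz => h0 ?_
    funext ⟨x, hx⟩
    have hx : x 0 = 1 := hx
    have hc : (Fin.cons 1 (Fin.tail x) : Fin (s + 1) → Kˣ) = x := by
      rw [← hx, Fin.cons_self_tail]
    have h := congrFun hz (Fin.tail x)
    simp only [hc] at h
    simp only [Pi.zero_apply] at h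
    simp [evLM, h]

end Homogenization

section ToricSet

variable {K : Type} [Field K] {m n : ℕ} [NeZero m]

lemma one_mem_toricSet (a : Fin m → Fin n → ℕ) : (1 : Fin m → Kˣ) ∈ toricSet K a :=
  ⟨1, by simp⟩

lemma mul_mem_toricSet {a : Fin m → Fin n → ℕ} {x y : Fin m → Kˣ} (hx : x ∈ toricSet K a)
    (hy : y ∈ toricSet K a) : x * y ∈ toricSet K a := by
  obtain ⟨t, ht⟩ := hx
  obtain ⟨u, hu⟩ := hy
  exact ⟨t * u, fun i => by simp [ht, hu, mul_zpow, Finset.prod_mul_distrib]⟩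

/-- A proper toric subset of the torus misses a point on a coordinate axis. -/
lemma exists_mulSingle_notMem_toricSet {a : Fin m → Fin n → ℕ}
    (h : toricSet K a ⊂ projTorus K m) :
    ∃ i : Fin m, i ≠ 0 ∧ ∃ z : Kˣ, Pi.mulSingle i z ∉ toricSet K a := by
  by_contra! hall
  refine h.2 fun x hx => ?_
  rw [← Finset.univ_prod_mulSingle x]
  refine Finset.prod_induction _ (· ∈ toricSet K a) (fun _ _ => mul_mem_toricSet)
    (one_mem_toricSet a) fun i _ => ?_
  by_cases hi : i = 0
  · subst hi
    rw [show x 0 = 1 from hx, Pi.mulSingle_one]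
    exact one_mem_toricSet a
  · exact hall i hi _

end ToricSet

/-- if `X ⊂ T_{m-1}` (proper) and `Y = T_{m-1} ∖ X`, then
`δ_{T_{m-1}}(d) ≥ δ_X(d) + δ_Y(d)` for `0 ≤ d < (m-1)(q-2)`. -/
theorem stmt11 {q m n : ℕ} (hq : IsPrimePow q) (hq3 : 3 ≤ q) (hm : 2 ≤ m) (hn : 1 ≤ n) [NeZero m]
    (K : Type) [Field K] [Fintype K] (hK : Fintype.card K = q)
    (a : Fin m → Fin n → ℕ)
    (hproper : toricSet K a ⊂ projTorus K m)
    (d : ℕ) (hd : d < (m - 1) * (q - 2)) :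
    minDist K (toricSet K a) d + minDist K (projTorus K m \ toricSet K a) d ≤
      minDist K (projTorus K m) d := by
  classical
  obtain ⟨s, rfl⟩ : ∃ s, m = s + 1 + 1 := ⟨m - 2, by omega⟩
  have hN : Fintype.card Kˣ = q - 1 := by
    rw [Fintype.card_units, hK]
  obtain ⟨i, hi, z, hz⟩ := exists_mulSingle_notMem_toricSet hproper
  obtain ⟨i, rfl⟩ := Fin.exists_succ_eq.2 hi
  obtain ⟨v, hv, hv1, hvz, hw⟩ := exists_wt_le_torusDist_of_lt (K := K) (s := s) (d := d)
    (by omega) (by simpa [hN, Nat.sub_sub] using hd) i z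
  obtain ⟨F, hF, hFv⟩ := exists_homogeneous_of_mem_torusPoly hv
  have hcons1 : (Fin.cons 1 1 : Fin (s + 1 + 1) → Kˣ) = 1 :=
    funext fun k => Fin.cases rfl (fun _ => rfl) k
  have hconsz : (Fin.cons 1 (Pi.mulSingle i z) : Fin (s + 1 + 1) → Kˣ) =
      Pi.mulSingle i.succ z := by
    funext k
    refine Fin.cases ?_ (fun k => ?_) k
    · simp [(Fin.succ_ne_zero i).symm]
    · simp [Pi.mulSingle_apply]
  have hX := minDist_le_wt_evLM hF (one_mem_toricSet (K := K) a)
    (by rw [← hcons1, hFv]; exact hv1)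
  have hY := minDist_le_wt_evLM (Z := projTorus K (s + 1 + 1) \ toricSet K a) hF
    (x := Pi.mulSingle i.succ z) ⟨by rw [← hconsz]; rfl, hz⟩
    (by rw [← hconsz, hFv]; exact hvz)
  refine (add_le_add hX hY).trans (le_trans ?_ (torusDist_le_minDist_projTorus K (s + 1) d))
  refine le_trans (le_of_eq ?_) hw
  have hT : wt (evLM K (projTorus K (s + 1 + 1)) d F) = wt v := by
    rw [wt_evLM_projTorus, funext hFv]
  rw [← hT, wt_evLM, wt_evLM, wt_evLM, ← Set.ncard_union_eq]
  · congr 1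
    ext x
    have := @hproper.1 x
    simp only [Set.mem_union, Set.mem_ofPred_eq, Set.mem_sdiff]
    tauto
  · rw [Set.disjoint_left]
    exact fun x hx hy => hy.1.2 hx.1
end
end

section
/- Let G be a connected graph and X the algebraic toric set associated to its incidence matrix. Then for every d ≥ 0: if G is bipartite, (q−1) · δ_X(d) ≥ δ_{T_{n−1}}(2d); if G is non-bipartite, δ_X(d) ≥ δ_{T_{n−1}}(2d). -/
open Finset MvPolynomial

noncomputable section

/-- The product of `t` over the vertices of the `i`-th row of an incidence matrix. -/
def rowProd {M : Type*} [CommMonoid M] {m n : ℕ} (a : Fin m → Fin n → ℕ) (t : Fin n → M)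
    (i : Fin m) : M :=
  ∏ j, t j ^ a i j

theorem prod_zpow_bmat {M : Type*} [CommGroup M] {m n : ℕ} [NeZero m] (a : Fin m → Fin n → ℕ)
    (t : Fin n → M) (i : Fin m) :
    ∏ j, t j ^ bmat a i j = rowProd a t i / rowProd a t 0 := by
  simp only [bmat, zpow_sub, zpow_natCast, rowProd, ← div_eq_mul_inv, Finset.prod_div_distrib]

theorem rowProd_div {M : Type*} [CommGroup M] {m n : ℕ} (a : Fin m → Fin n → ℕ)
    (s t : Fin n → M) (i : Fin m) :
    rowProd a (s / t) i = rowProd a s i / rowProd a t i := by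
  simp [rowProd, div_pow, Finset.prod_div_distrib]

section Incidence

variable {m n : ℕ} {G : SimpleGraph (Fin n)} {e : Fin m ≃ G.edgeSet} {a : Fin m → Fin n → ℕ}

theorem rowProd_eq_mul_of_adj {M : Type*} [CommMonoid M]
    (hA : ∀ i j, a i j = if j ∈ (e i : Sym2 (Fin n)) then 1 else 0)
    (t : Fin n → M) {u v : Fin n} (h : G.Adj u v) :
    rowProd a t (e.symm ⟨s(u, v), h⟩) = t u * t v := by
  have hne : u ≠ v := h.ne
  rw [rowProd, ← Finset.prod_pair hne]
  simp only [hA, Equiv.apply_symm_apply, Sym2.mem_iff]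
  rw [← Finset.prod_subset (Finset.subset_univ {u, v})]
  · refine Finset.prod_congr rfl fun j hj => ?_
    rw [if_pos (by simpa using hj), pow_one]
  · intro j _ hj
    rw [if_neg (by simpa using hj), pow_zero]

theorem sum_row_eq_two (hA : ∀ i j, a i j = if j ∈ (e i : Sym2 (Fin n)) then 1 else 0)
    (i : Fin m) : ∑ j, a i j = 2 := by
  obtain ⟨⟨p, hp⟩, hi⟩ : ∃ p, p = e i := ⟨_, rfl⟩
  induction p with
  | _ u v =>
    have h := rowProd_eq_mul_of_adj hA (fun _ => Multiplicative.ofAdd 1) (G.mem_edgeSet.1 hp)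
    rw [show e.symm ⟨s(u, v), G.mem_edgeSet.1 hp⟩ = i from e.symm_apply_eq.2 hi] at h
    simpa [rowProd] using congrArg Multiplicative.toAdd h

/-- On a connected graph, a labelling with constant edge products takes at most two values. -/
theorem eq_one_or_eq_of_mul_eq {V M : Type*} [Group M] {G : SimpleGraph V} (hG : G.Connected)
    {r : V → M} {c : M} (hr : ∀ u v, G.Adj u v → r u * r v = c) {o : V} (ho : r o = 1) (w : V) :
    r w = 1 ∨ r w = c := by
  obtain ⟨p⟩ := hG.preconnected w o
  induction p with
  | nil => exact Or.inl ho
  | cons h p ih =>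
    have := hr _ _ h
    rcases ih ho with h1 | h1
    · right; rwa [h1, mul_one] at this
    · left; rw [h1] at this; exact mul_eq_right.1 this

theorem colorable_two_of_mul_eq {V M : Type*} [Group M] {G : SimpleGraph V} (hG : G.Connected)
    {r : V → M} {c : M} (hc : c ≠ 1) (hr : ∀ u v, G.Adj u v → r u * r v = c) {o : V}
    (ho : r o = 1) : G.Colorable 2 := by
  classical
  let C : G.Coloring Bool := SimpleGraph.Coloring.mk (fun w => decide (r w = 1)) (by
    intro u v h heq
    have huv := hr u v h
    rcases eq_one_or_eq_of_mul_eq hG hr ho u with hu | hu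
    · rw [hu, one_mul] at huv
      simp [hu, huv, hc] at heq
    · rw [hu] at huv
      simp [hu, mul_eq_left.1 huv, hc] at heq)
  simpa using C.colorable

end Incidence

theorem eval_mul_of_isHomogeneous {R σ : Type*} [CommSemiring R] {f : MvPolynomial σ R} {d : ℕ}
    (hf : f.IsHomogeneous d) (c : R) (x : σ → R) :
    eval (fun i => c * x i) f = c ^ d * eval x f := by
  rw [eval_eq, eval_eq, Finset.mul_sum]
  refine Finset.sum_congr rfl fun s hs => ?_
  have hd : ∑ i ∈ s.support, s i = d := by
    have := hf (mem_support_iff.1 hs)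
    simpa [Finsupp.weight_apply, Finsupp.sum] using this
  simp only [mul_pow, Finset.prod_mul_distrib, Finset.prod_pow_eq_pow_sum, hd]
  ring

theorem minDist_le_wt (K : Type) [Field K] {m : ℕ} [NeZero m] {Z : Set (Fin m → Kˣ)} {d : ℕ}
    {v : Z → K} (hv : v ∈ evalCode K Z d) (h0 : v ≠ 0) : minDist K Z d ≤ wt v :=
  Nat.sInf_le ⟨v, hv, h0, rfl⟩

theorem exists_wt_eq_minDist (K : Type) [Field K] {m : ℕ} [NeZero m] {Z : Set (Fin m → Kˣ)}
    (hZ : Z.Nonempty) (d : ℕ) :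
    ∃ v ∈ evalCode K Z d, v ≠ 0 ∧ wt v = minDist K Z d := by
  obtain ⟨P, hP⟩ := hZ
  refine Nat.sInf_mem (s := {w | ∃ v ∈ evalCode K Z d, v ≠ 0 ∧ wt v = w})
    ⟨_, evLM K Z d (X 0 ^ d), Submodule.mem_map_of_mem ?_, fun h => ?_, rfl⟩
  · simpa using (isHomogeneous_X K (0 : Fin m)).pow d
  · simpa [evLM] using congrFun h ⟨P, hP⟩

/-- If the parametrization of a toric set by a torus has fibres of size at most `N`, then minimum
distances compare up to the factor `N`. -/
theorem minDist_projTorus_le (K : Type) [Field K] [Fintype K] {m n k : ℕ} [NeZero m] [NeZero n]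
    (a : Fin m → Fin n → ℕ) (ha : ∀ i, ∑ j, a i j = k) (N d : ℕ)
    (hN : ∀ t ∈ projTorus K n, {s ∈ projTorus K n |
      ∀ i, rowProd a s i / rowProd a s 0 = rowProd a t i / rowProd a t 0}.ncard ≤ N) :
    minDist K (projTorus K n) (k * d) ≤ N * minDist K (toricSet K a) d := by
  classical
  obtain ⟨v, ⟨f, hf, rfl⟩, hv0, hv⟩ :=
    exists_wt_eq_minDist K (Z := toricSet K a) ⟨_, 1, fun _ => rfl⟩ d
  let φ : projTorus K n → toricSet K a := fun t => ⟨_, t.1, fun _ => rfl⟩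
  have hφ : ∀ t i, (φ t).1 i = rowProd a t.1 i / rowProd a t.1 0 := fun t i =>
    prod_zpow_bmat a t.1 i
  have hsurj : Function.Surjective φ := by
    rintro ⟨x, t, ht⟩
    have hsc : ∀ i, rowProd a (fun j => t j / t 0) i = rowProd a t i / t 0 ^ k := fun i => by
      simp [rowProd, div_pow, Finset.prod_div_distrib, Finset.prod_pow_eq_pow_sum, ha]
    refine ⟨⟨fun j => t j / t 0, by simp [projTorus]⟩, Subtype.ext (funext fun i => ?_)⟩
    rw [hφ]
    simp only [hsc, ht, prod_zpow_bmat, div_div_div_cancel_right]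
  let g : MvPolynomial (Fin n) K := aeval (fun i => rowProd a X i) f
  have hg : g.IsHomogeneous (k * d) := by
    refine IsHomogeneous.aeval hf _ fun i => ?_
    rw [← ha i]
    refine IsHomogeneous.prod _ _ _ fun j _ => ?_
    simpa using (isHomogeneous_X K j).pow (a i j)
  have hev : ∀ t : projTorus K n, evLM K (projTorus K n) (k * d) g t =
      ((rowProd a t.1 0 : Kˣ) : K) ^ d * evLM K (toricSet K a) d f (φ t) := by
    intro t
    have h0 : (t.1 0 : Kˣ) = 1 := t.2
    have h1 : (φ t).1 0 = 1 := by rw [hφ, div_self']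
    have h2 : eval (fun i => (t.1 i : K)) g = eval (fun i => ((rowProd a t.1 i : Kˣ) : K)) f := by
      simp only [g, ← aeval_eq_eval, comp_aeval_apply]
      simp [rowProd]
    simp only [evLM, LinearMap.coe_mk, AddHom.coe_mk, h0, h1, Units.val_one, one_pow, div_one, h2]
    rw [← eval_mul_of_isHomogeneous hf]
    congr 2
    funext i
    rw [hφ, ← Units.val_mul, mul_div_cancel]
  have hiff : ∀ t, evLM K (projTorus K n) (k * d) g t ≠ 0 ↔
      evLM K (toricSet K a) d f (φ t) ≠ 0 := fun t => by
    rw [hev]; simp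
  have hne : evLM K (projTorus K n) (k * d) g ≠ 0 := by
    obtain ⟨P, hP⟩ := Function.ne_iff.1 hv0
    obtain ⟨t, rfl⟩ := hsurj P
    exact Function.ne_iff.2 ⟨t, (hiff t).2 hP⟩
  refine (minDist_le_wt K (Submodule.mem_map_of_mem hg) hne).trans ?_
  rw [← hv, wt, wt, Set.ncard_eq_toFinset_card', Set.ncard_eq_toFinset_card']
  refine Finset.card_le_mul_card_image_of_maps_to (f := φ) (fun t ht => ?_) N fun P _ => ?_
  · simpa [hiff] using ht
  · obtain ⟨t, rfl⟩ := hsurj P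
    refine le_trans ?_ (hN t.1 t.2)
    rw [← Set.ncard_coe_finset]
    refine Set.ncard_le_ncard_of_injOn Subtype.val (fun s hs => ⟨s.2, fun i => ?_⟩)
      Subtype.val_injective.injOn (Set.toFinite _)
    rw [← hφ, ← hφ]
    have : φ s = φ t := by simp at hs; exact hs.2
    rw [this]

/-- for a connected graph `G` with incidence matrix `a`, for every `d ≥ 0`:
if `G` is bipartite then `(q-1) · δ_X(d) ≥ δ_{T_{n-1}}(2d)`, and if `G` is
non-bipartite then `δ_X(d) ≥ δ_{T_{n-1}}(2d)`. -/
theorem stmt14 {q m n : ℕ} (hq : IsPrimePow q) (hm : 1 ≤ m) (hn : 2 ≤ n) [NeZero m] [NeZero n]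
    (K : Type) [Field K] [Fintype K] (hK : Fintype.card K = q)
    (G : SimpleGraph (Fin n)) (e : Fin m ≃ G.edgeSet)
    (a : Fin m → Fin n → ℕ)
    (hA : ∀ i j, a i j = if j ∈ (e i : Sym2 (Fin n)) then 1 else 0)
    (hconn : G.Connected) (d : ℕ) :
    (G.Colorable 2 →
      minDist K (projTorus K n) (2 * d) ≤ (q - 1) * minDist K (toricSet K a) d) ∧
    (¬ G.Colorable 2 →
      minDist K (projTorus K n) (2 * d) ≤ minDist K (toricSet K a) d) := by
  classical
  have hmul : ∀ s t : Fin n → Kˣ,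
      (∀ i, rowProd a s i / rowProd a s 0 = rowProd a t i / rowProd a t 0) →
      ∀ u v, G.Adj u v → (s / t) u * (s / t) v = rowProd a s 0 / rowProd a t 0 := by
    intro s t h u v huv
    rw [← rowProd_eq_mul_of_adj hA _ huv, rowProd_div, div_eq_div_iff_div_eq_div]
    exact h _
  have hone : ∀ s ∈ projTorus K n, ∀ t ∈ projTorus K n, (s / t) 0 = 1 := fun s hs t ht => by
    rw [Pi.div_apply, show s 0 = 1 from hs, show t 0 = 1 from ht, div_one]
  have hinj : ∀ s ∈ projTorus K n, ∀ t ∈ projTorus K n,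
      (∀ i, rowProd a s i / rowProd a s 0 = rowProd a t i / rowProd a t 0) →
      rowProd a s 0 = rowProd a t 0 → s = t := by
    intro s hs t ht h h0
    refine div_eq_one.1 (funext fun w => ?_)
    have := eq_one_or_eq_of_mul_eq hconn (hmul s t h) (hone s hs t ht) w
    simpa [h0] using this
  refine ⟨fun _ => minDist_projTorus_le K a (sum_row_eq_two hA) _ d fun t ht => ?_, fun hG => ?_⟩
  · rw [← hK, ← Fintype.card_units, ← Nat.card_eq_fintype_card, ← Set.ncard_univ]
    refine Set.ncard_le_ncard_of_injOn (fun s => rowProd a s 0) (fun _ _ => Set.mem_univ _) ?_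
      (Set.toFinite _)
    intro s hs s' hs' h
    exact hinj s hs.1 s' hs'.1 (fun i => (hs.2 i).trans (hs'.2 i).symm) h
  · rw [← one_mul (minDist K (toricSet K a) d)]
    refine minDist_projTorus_le K a (sum_row_eq_two hA) 1 d fun t ht => ?_
    refine (Set.ncard_le_one (Set.toFinite _)).2 fun s hs s' hs' => ?_
    have h := fun i => (hs.2 i).trans (hs'.2 i).symm
    refine hinj s hs.1 s' hs'.1 h (by_contra fun hc => hG ?_)
    exact colorable_two_of_mul_eq hconn (mt div_eq_one.1 hc) (hmul s s' h) (hone s hs.1 s' hs'.1)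
end
end
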